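/- For every extreme point x of the subtour polytope S^n, the number m of edges in the support graph of x satisfies n ≤ m ≤ 2n − 3, with m = n if and only if x is the incidence vector of a Hamiltonian cycle. -/

import Mathlib

open Finset
open scoped Classical

noncomputable section

/-- Edge set of the complete graph `K_n` as non-diagonal elements of `Sym2 (Fin n)`. -/
def edgeSet (n : ℕ) : Finset (Sym2 (Fin n)) :=
  Finset.univ.filter (fun e => ¬ e.IsDiag)

/-- The cut `δ(S)`: edges with exactly one endpoint in `S`. -/
def cut {n : ℕ} (S : Finset (Fin n)) : Finset (Sym2 (Fin n)) :=
  Finset.univ.filter (fun e => ¬ e.IsDiag ∧ ∃ u v : Fin n, e = s(u, v) ∧ u ∈ S ∧ v ∉ S)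

/-- Membership in the subtour polytope `S^n`. -/
def InSubtour (n : ℕ) (x : Sym2 (Fin n) → ℝ) : Prop :=
  (∀ e ∈ edgeSet n, 0 ≤ x e ∧ x e ≤ 1) ∧
  (∀ v : Fin n, ∑ e ∈ cut ({v} : Finset (Fin n)), x e = 2) ∧
  (∀ S : Finset (Fin n), 2 ≤ S.card → S.card ≤ n - 2 → 2 ≤ ∑ e ∈ cut S, x e)

/-- Extreme point of the subtour polytope: not a proper convex combination
(equivalently, not the midpoint of two distinct points of `S^n`). -/
def IsExtremePt (n : ℕ) (x : Sym2 (Fin n) → ℝ) : Prop :=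
  InSubtour n x ∧
  ∀ y z : Sym2 (Fin n) → ℝ, InSubtour n y → InSubtour n z →
    (∀ e ∈ edgeSet n, x e = (y e + z e) / 2) → ∀ e ∈ edgeSet n, y e = z e

/-- Support edges of `x`: edges with strictly positive value. -/
def supportEdges {n : ℕ} (x : Sym2 (Fin n) → ℝ) : Finset (Sym2 (Fin n)) :=
  (edgeSet n).filter (fun e => 0 < x e)

/-- Degree of a vertex in the support graph of `x`. -/
def supDeg {n : ℕ} (x : Sym2 (Fin n) → ℝ) (v : Fin n) : ℕ :=
  (cut ({v} : Finset (Fin n)) ∩ supportEdges x).card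

/-- `x` is the incidence vector of a Hamiltonian cycle of `K_n`. -/
def IsHamCycle (n : ℕ) (x : Sym2 (Fin n) → ℝ) : Prop :=
  ∃ σ : Equiv.Perm (Fin n), σ.IsCycle ∧ σ.support = Finset.univ ∧
    ∀ e ∈ edgeSet n, x e = if (∃ v : Fin n, e = s(v, σ v)) then 1 else 0

/-- Cost `c^T x` over the edges of `K_n`. -/
def cost {n : ℕ} (c x : Sym2 (Fin n) → ℝ) : ℝ := ∑ e ∈ edgeSet n, c e * x e

/-- `c` is a metric cost function: nonnegative (symmetry is built into `Sym2`)
and satisfying the triangle inequality. -/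
def IsMetricCost (n : ℕ) (c : Sym2 (Fin n) → ℝ) : Prop :=
  (∀ e, 0 ≤ c e) ∧ ∀ i j k : Fin n, c s(i, k) ≤ c s(i, j) + c s(j, k)

/-- Two sets are laminar when they are nested or disjoint. -/
def Laminar {α : Type*} (S T : Finset α) : Prop := S ⊆ T ∨ T ⊆ S ∨ Disjoint S T

theorem Laminar.symm {α : Type*} {S T : Finset α} (h : Laminar S T) : Laminar T S := by
  rcases h with h | h | h
  · exact Or.inr (Or.inl h)
  · exact Or.inl h
  · exact Or.inr (Or.inr h.symm)

theorem Laminar.inter {α : Type*} [DecidableEq α] {R S T : Finset α} (hS : Laminar R S) (hT : Laminar R T) :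
    Laminar R (S ∩ T) := by
  simp only [Laminar, Finset.subset_iff, Finset.disjoint_left, mem_inter] at *
  grind

theorem Laminar.union {α : Type*} [DecidableEq α] {R S T : Finset α} (hS : Laminar R S) (hT : Laminar R T)
    (hST : (S ∩ T).Nonempty) : Laminar R (S ∪ T) := by
  obtain ⟨a, ha⟩ := hST
  simp only [Laminar, Finset.subset_iff, Finset.disjoint_left, mem_inter, mem_union] at *
  grind

theorem Laminar.erase {α : Type*} [DecidableEq α] {S T : Finset α} (h : Laminar S T) (a : α) :
    Laminar (S.erase a) (T.erase a) := by
  rcases h with h | h | h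
  · exact Or.inl (erase_subset_erase a h)
  · exact Or.inr (Or.inl (erase_subset_erase a h))
  · exact Or.inr (Or.inr (h.mono (erase_subset a S) (erase_subset a T)))

/-- A laminar family of nonempty subsets of a nonempty set `U` has at most `2 |U| - 1` members. -/
theorem card_laminar_family_add_one_le {α : Type*} [DecidableEq α] (U : Finset α) (hU : U.Nonempty)
    (L : Finset (Finset α)) (hLU : ∀ S ∈ L, S ⊆ U) (hne : ∀ S ∈ L, S.Nonempty)
    (hL : ∀ S ∈ L, ∀ T ∈ L, Laminar S T) : #L + 1 ≤ 2 * #U := by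
  induction hU using Finset.Nonempty.cons_induction generalizing L with
  | singleton a =>
    have hsub : L ⊆ {{a}} := fun S hS => by
      rw [mem_singleton]
      exact ((Finset.subset_singleton_iff.1 (hLU S hS)).resolve_left (hne S hS).ne_empty)
    have := card_le_card hsub
    simp only [card_singleton] at this ⊢
    lia
  | cons a U ha hU ih =>
    set A := L.filter (fun S => a ∉ S) with hA
    set B := L.filter (fun S => a ∈ S ∧ S ≠ {a}) with hB
    set C := B.image (fun S => S.erase a) with hC
    have hcardB : #C = #B := by
      refine card_image_of_injOn fun S hS T hT h => ?_
      simp only [hB, coe_filter, Set.mem_ofPred_eq] at hS hT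
      rw [← insert_erase hS.2.1, ← insert_erase hT.2.1, show S.erase a = T.erase a from h]
    have hcardL : #L ≤ #A + #B + 1 := by
      have hsub : L ⊆ (A ∪ B) ∪ {{a}} := by
        intro S hS
        simp only [hA, hB, mem_union, mem_filter, mem_singleton]
        tauto
      refine (card_le_card hsub).trans ((card_union_le _ _).trans ?_)
      have := card_union_le A B
      simp only [card_singleton]
      lia
    have hmemA : ∀ S, S ∈ A → S ∈ L ∧ a ∉ S := fun S hS => by simpa [hA] using hS
    have hmemC : ∀ S, S ∈ C → insert a S ∈ L ∧ a ∉ S ∧ S.Nonempty := by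
      intro S hS
      simp only [hC, hB, mem_image, mem_filter] at hS
      obtain ⟨T, ⟨hT, haT, hTa⟩, rfl⟩ := hS
      refine ⟨by rwa [insert_erase haT], notMem_erase a T, ?_⟩
      rw [nonempty_iff_ne_empty, Ne, erase_eq_empty_iff]
      rintro (h | h)
      · exact (hne T hT).ne_empty h
      · exact hTa h
    have hinter : #(A ∩ C) ≤ 1 := by
      refine card_le_one.2 fun S hS T hT => ?_
      rw [mem_inter] at hS hT
      obtain ⟨hS1, haS⟩ := hmemA S hS.1
      obtain ⟨hT1, haT⟩ := hmemA T hT.1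
      obtain ⟨hS2, -, s, hs⟩ := hmemC S hS.2
      obtain ⟨hT2, -, t, ht⟩ := hmemC T hT.2
      have h1 := hL _ hS2 _ hT2
      have h2 := hL _ hS2 _ hT1
      have h3 := hL _ hS1 _ hT2
      simp only [Laminar, Finset.subset_iff, Finset.disjoint_left, mem_insert] at h1 h2 h3
      ext b
      grind
    have hAC : #(A ∪ C) + 1 ≤ 2 * #U := by
      have hor : ∀ S ∈ A ∪ C, a ∉ S ∧ S.Nonempty ∧ (S ∈ L ∨ insert a S ∈ L) := by
        intro S hS
        rcases mem_union.1 hS with h | h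
        · exact ⟨(hmemA S h).2, hne S (hmemA S h).1, Or.inl (hmemA S h).1⟩
        · exact ⟨(hmemC S h).2.1, (hmemC S h).2.2, Or.inr (hmemC S h).1⟩
      refine ih _ (fun S hS b hb => ?_) (fun S hS => (hor S hS).2.1) (fun S hS T hT => ?_)
      · obtain ⟨haS, -, h⟩ := hor S hS
        have hbU : b ∈ cons a U ha := by
          rcases h with h | h
          · exact hLU _ h hb
          · exact hLU _ h (mem_insert_of_mem hb)
        rcases mem_cons.1 hbU with rfl | h
        · exact absurd hb haS
        · exact h
      · obtain ⟨haS, -, hS⟩ := hor S hS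
        obtain ⟨haT, -, hT⟩ := hor T hT
        rcases hS with hS | hS <;> rcases hT with hT | hT <;>
          simpa [haS, haT] using (hL _ hS _ hT).erase a
    have := card_union_add_card_inter A C
    rw [card_cons]
    lia

/-- Uncrossing: a family closed under intersections and unions of intersecting pairs contains
a laminar subfamily such that any function that is modular on intersecting pairs and vanishes on
the subfamily vanishes on the whole family. -/
theorem exists_laminar_determining_subfamily {α : Type*} [DecidableEq α] (F : Finset (Finset α))
    (hF : ∀ S ∈ F, ∀ T ∈ F, (S ∩ T).Nonempty → S ∩ T ∈ F ∧ S ∪ T ∈ F) :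
    ∃ L ⊆ F, (∀ S ∈ L, ∀ T ∈ L, Laminar S T) ∧
      ∀ g : Finset α → ℝ,
        (∀ S ∈ F, ∀ T ∈ F, (S ∩ T).Nonempty → g S + g T = g (S ∩ T) + g (S ∪ T)) →
        (∀ S ∈ L, g S = 0) → ∀ S ∈ F, g S = 0 := by
  obtain ⟨L, hLmem, hLmax⟩ := exists_max_image
    (F.powerset.filter fun L => ∀ S ∈ L, ∀ T ∈ L, Laminar S T) card ⟨∅, by simp⟩
  simp only [mem_filter, mem_powerset] at hLmem hLmax
  obtain ⟨hLF, hL⟩ := hLmem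
  refine ⟨L, hLF, hL, fun g hg hg0 => ?_⟩
  suffices H : ∀ k : ℕ, ∀ T ∈ F, #(L.filter fun S => ¬ Laminar S T) = k → g T = 0 from
    fun T hT => H _ T hT rfl
  intro k
  induction k using Nat.strong_induction_on with
  | _ k ih =>
    intro T hT hk
    by_cases hcross : ∃ S ∈ L, ¬ Laminar S T
    · obtain ⟨S, hSL, hST⟩ := hcross
      have hint : (S ∩ T).Nonempty := by
        rw [← not_disjoint_iff_nonempty_inter]
        exact fun h => hST (Or.inr (Or.inr h))
      obtain ⟨hI, hU⟩ := hF S (hLF hSL) T hT hint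
      have hlt : ∀ T', Laminar S T' → (∀ R ∈ L, Laminar R T → Laminar R T') →
          #(L.filter fun S => ¬ Laminar S T') < k := by
        intro T' hS hR
        rw [← hk]
        refine card_lt_card (ssubset_iff_of_subset ?_ |>.2 ⟨S, ?_, ?_⟩)
        · exact fun R hRm => by
            rw [mem_filter] at hRm ⊢
            exact ⟨hRm.1, fun h => hRm.2 (hR R hRm.1 h)⟩
        · simp [hSL, hST]
        · simp [hS]
      have hgI := ih _ (hlt (S ∩ T) (Or.inr (Or.inl inter_subset_left))
        fun R hR h => (hL R hR S hSL).inter h) _ hI rfl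
      have hgU := ih _ (hlt (S ∪ T) (Or.inl subset_union_left)
        fun R hR h => (hL R hR S hSL).union h hint) _ hU rfl
      have := hg S (hLF hSL) T hT hint
      rw [hgI, hgU, hg0 S hSL] at this
      linarith
    · push Not at hcross
      refine hg0 T (by_contra fun hTL => ?_)
      have := hLmax (insert T L) ⟨insert_subset hT hLF, ?_⟩
      · rw [card_insert_of_notMem hTL] at this
        lia
      · intro A hA B hB
        rcases mem_insert.1 hA with hA | hA <;> rcases mem_insert.1 hB with hB | hB
        · exact Or.inl (hA.trans hB.symm).subset
        · exact hA ▸ (hcross B hB).symm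
        · exact hB ▸ hcross A hA
        · exact hL A hA B hB

theorem mem_cut {n : ℕ} {S : Finset (Fin n)} {u v : Fin n} :
    s(u, v) ∈ cut S ↔ (u ∈ S ∧ v ∉ S) ∨ (v ∈ S ∧ u ∉ S) := by
  simp only [cut, mem_filter, mem_univ, true_and, Sym2.mk_isDiag_iff]
  constructor
  · rintro ⟨-, a, b, h, ha, hb⟩
    rcases Sym2.eq_iff.1 h with ⟨rfl, rfl⟩ | ⟨rfl, rfl⟩
    · exact Or.inl ⟨ha, hb⟩
    · exact Or.inr ⟨ha, hb⟩
  · rintro (⟨ha, hb⟩ | ⟨ha, hb⟩)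
    · exact ⟨fun h => hb (h ▸ ha), u, v, rfl, ha, hb⟩
    · exact ⟨fun h => hb (h ▸ ha), v, u, Sym2.eq_swap, ha, hb⟩

theorem cut_subset_edgeSet {n : ℕ} (S : Finset (Fin n)) : cut S ⊆ edgeSet n := fun e he => by
  simp only [cut, edgeSet, mem_filter, mem_univ, true_and] at he ⊢
  exact he.1

theorem mem_edgeSet {n : ℕ} {u v : Fin n} : s(u, v) ∈ edgeSet n ↔ u ≠ v := by
  simp [edgeSet]

theorem cut_compl {n : ℕ} (S : Finset (Fin n)) : cut Sᶜ = cut S := by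
  ext e
  induction e using Sym2.ind with
  | _ u v =>
    simp only [mem_cut, mem_compl]
    tauto

/-- The total weight of the cut `δ(S)`. -/
def cutSum {n : ℕ} (d : Sym2 (Fin n) → ℝ) (S : Finset (Fin n)) : ℝ := ∑ e ∈ cut S, d e

theorem cutSum_compl {n : ℕ} (d : Sym2 (Fin n) → ℝ) (S : Finset (Fin n)) :
    cutSum d Sᶜ = cutSum d S := by
  rw [cutSum, cutSum, cut_compl]

/-- The edges between `S \ T` and `T \ S`. -/
def crossEdges {n : ℕ} (S T : Finset (Fin n)) : Finset (Sym2 (Fin n)) :=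
  (cut S ∩ cut T) \ cut (S ∩ T)

theorem cutSum_add_cutSum {n : ℕ} (d : Sym2 (Fin n) → ℝ) (S T : Finset (Fin n)) :
    cutSum d S + cutSum d T =
      cutSum d (S ∩ T) + cutSum d (S ∪ T) + 2 * ∑ e ∈ crossEdges S T, d e := by
  have key : ∀ A : Finset (Sym2 (Fin n)), ∑ e ∈ A, d e = ∑ e, if e ∈ A then d e else 0 :=
    fun A => by rw [sum_ite_mem, univ_inter]
  simp only [cutSum, key, mul_sum, ← sum_add_distrib]
  refine sum_congr rfl fun e _ => ?_
  induction e using Sym2.ind with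
  | _ u v =>
    simp only [crossEdges, mem_sdiff, mem_cut, mem_inter, mem_union]
    by_cases h1 : u ∈ S <;> by_cases h2 : v ∈ S <;> by_cases h3 : u ∈ T <;>
      by_cases h4 : v ∈ T <;> simp [h1, h2, h3, h4] <;> ring

theorem crossEdges_singleton {n : ℕ} {u v : Fin n} (h : u ≠ v) :
    crossEdges {u} {v} = {s(u, v)} := by
  ext e
  induction e using Sym2.ind with
  | _ a b =>
    simp only [crossEdges, mem_sdiff, mem_cut, mem_inter, mem_singleton, Sym2.eq_iff]
    grind

theorem cutSum_empty {n : ℕ} (d : Sym2 (Fin n) → ℝ) : cutSum d ∅ = 0 := by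
  simp [cutSum, cut]

theorem cutSum_pair {n : ℕ} (d : Sym2 (Fin n) → ℝ) {u v : Fin n} (h : u ≠ v) :
    cutSum d {u} + cutSum d {v} = cutSum d {u, v} + 2 * d s(u, v) := by
  rw [cutSum_add_cutSum, crossEdges_singleton h, singleton_inter_of_notMem (by simp [h]),
    cutSum_empty, sum_singleton, zero_add]
  rfl

theorem InSubtour.two_le_cutSum {n : ℕ} {x : Sym2 (Fin n) → ℝ} (hx : InSubtour n x)
    {S : Finset (Fin n)} (hS : S.Nonempty) (hS' : S ≠ univ) : 2 ≤ cutSum x S := by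
  have hcompl : #S + #Sᶜ = n := by simp
  have hpos := hS.card_pos
  have hpos' : 0 < #Sᶜ := by
    rwa [card_pos, nonempty_iff_ne_empty, Ne, compl_eq_empty_iff]
  by_cases h1 : #S = 1
  · obtain ⟨v, rfl⟩ := card_eq_one.1 h1
    exact (hx.2.1 v).ge
  by_cases h2 : #Sᶜ = 1
  · obtain ⟨v, hv⟩ := card_eq_one.1 h2
    rw [← cutSum_compl, hv]
    exact (hx.2.1 v).ge
  exact hx.2.2 S (by lia) (by lia)

theorem InSubtour.sum_crossEdges_nonneg {n : ℕ} {x : Sym2 (Fin n) → ℝ} (hx : InSubtour n x)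
    (S T : Finset (Fin n)) : 0 ≤ ∑ e ∈ crossEdges S T, x e :=
  sum_nonneg fun e he => (hx.1 e (cut_subset_edgeSet S
    (mem_inter.1 (mem_sdiff.1 he).1).1)).1

/-- Tight sets can be uncrossed. -/
theorem InSubtour.uncross {n : ℕ} {x : Sym2 (Fin n) → ℝ} (hx : InSubtour n x)
    {S T : Finset (Fin n)} (hS : cutSum x S = 2) (hT : cutSum x T = 2)
    (hI : (S ∩ T).Nonempty) (hU : S ∪ T ≠ univ) :
    cutSum x (S ∩ T) = 2 ∧ cutSum x (S ∪ T) = 2 ∧ ∀ e ∈ crossEdges S T, x e = 0 := by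
  have hid := cutSum_add_cutSum x S T
  have h0 := hx.sum_crossEdges_nonneg S T
  have h1 : 2 ≤ cutSum x (S ∩ T) := hx.two_le_cutSum hI fun h =>
    hU (univ_subset_iff.1 (h ▸ inter_subset_left.trans subset_union_left))
  have h2 : 2 ≤ cutSum x (S ∪ T) := hx.two_le_cutSum
    (hI.mono (inter_subset_left.trans subset_union_left)) hU
  refine ⟨by linarith, by linarith, (sum_eq_zero_iff_of_nonneg fun e he => ?_).1 (by linarith)⟩
  exact (hx.1 e (cut_subset_edgeSet S (mem_inter.1 (mem_sdiff.1 he).1).1)).1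

/-- A direction supported on the support of `x` along which every tight constraint is constant
can be followed both ways inside the polytope, so it vanishes at an extreme point. -/
theorem IsExtremePt.direction_eq_zero {n : ℕ} (hn : 3 ≤ n) {x : Sym2 (Fin n) → ℝ}
    (hx : IsExtremePt n x) {d : Sym2 (Fin n) → ℝ} (hd : ∀ e ∈ edgeSet n, x e = 0 → d e = 0)
    (htight : ∀ S : Finset (Fin n), S.Nonempty → S ≠ univ → cutSum x S = 2 → cutSum d S = 0) :
    ∀ e ∈ edgeSet n, d e = 0 := by
  have hone : ∀ e ∈ edgeSet n, 1 - x e = 0 → d e = 0 := by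
    intro e
    induction e using Sym2.ind with
    | _ u v =>
      intro he h1
      have huv := mem_edgeSet.1 he
      have hproper : ∀ S : Finset (Fin n), #S ≤ 2 → S ≠ univ := by
        rintro S hS rfl
        rw [card_univ, Fintype.card_fin] at hS
        lia
      have hu : cutSum x {u} = 2 := hx.1.2.1 u
      have hv : cutSum x {v} = 2 := hx.1.2.1 v
      have hdu := htight {u} (singleton_nonempty u) (hproper _ (by simp)) hu
      have hdv := htight {v} (singleton_nonempty v) (hproper _ (by simp)) hv
      have hxp := cutSum_pair x huv
      have hdp := cutSum_pair d huv
      have := htight {u, v} (insert_nonempty _ _) (hproper _ card_le_two) (by linarith)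
      linarith
  have hev : ∀ a b : ℝ, 0 ≤ a → (a = 0 → b = 0) →
      ∀ᶠ t in nhdsWithin (0 : ℝ) (Set.Ioi 0), 0 ≤ a + t * b ∧ 0 ≤ a - t * b := by
    intro a b ha hab
    rcases ha.eq_or_lt with rfl | ha
    · simp [hab rfl]
    · have h1 : Filter.Tendsto (fun t : ℝ => a + t * b) (nhds 0) (nhds a) := by
        have : Continuous fun t : ℝ => a + t * b := by fun_prop
        simpa using this.tendsto 0
      have h2 : Filter.Tendsto (fun t : ℝ => a - t * b) (nhds 0) (nhds a) := by
        have : Continuous fun t : ℝ => a - t * b := by fun_prop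
        simpa using this.tendsto 0
      filter_upwards [nhdsWithin_le_nhds (h1.eventually_const_le ha),
        nhdsWithin_le_nhds (h2.eventually_const_le ha)] with t h h' using ⟨h, h'⟩
  have hev0 : ∀ᶠ t in nhdsWithin (0 : ℝ) (Set.Ioi 0), ∀ e : Sym2 (Fin n), e ∈ edgeSet n →
      (0 ≤ x e + t * d e ∧ 0 ≤ x e - t * d e) ∧
      (0 ≤ 1 - x e + t * d e ∧ 0 ≤ 1 - x e - t * d e) := by
    refine Filter.eventually_all.2 fun e => ?_
    by_cases he : e ∈ edgeSet n
    · filter_upwards [hev (x e) (d e) (hx.1.1 e he).1 (hd e he),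
        hev (1 - x e) (d e) (by linarith [(hx.1.1 e he).2]) (hone e he)] with t h h' _
        using ⟨h, h'⟩
    · simp [he]
  have hevS : ∀ᶠ t in nhdsWithin (0 : ℝ) (Set.Ioi 0), ∀ S : Finset (Fin n),
      (S.Nonempty ∧ S ≠ univ) → 0 ≤ cutSum x S - 2 + t * cutSum d S ∧
        0 ≤ cutSum x S - 2 - t * cutSum d S := by
    refine Filter.eventually_all.2 fun S => ?_
    by_cases hS : S.Nonempty ∧ S ≠ univ
    · filter_upwards [hev (cutSum x S - 2) (cutSum d S)
        (by linarith [hx.1.two_le_cutSum hS.1 hS.2])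
        fun h => htight S hS.1 hS.2 (by linarith)] with t h _ using h
    · simp [hS]
  obtain ⟨t, ⟨ht0, htS⟩, ht⟩ := ((hev0.and hevS).and self_mem_nhdsWithin).exists
  have hsum : ∀ (c : ℝ) (S : Finset (Fin n)),
      ∑ e ∈ cut S, (x e + c * d e) = cutSum x S + c * cutSum d S := by
    intro c S
    rw [sum_add_distrib, ← mul_sum]
    rfl
  have hin : ∀ c : ℝ, c = t ∨ c = -t → InSubtour n fun e => x e + c * d e := by
    intro c hc
    refine ⟨fun e he => ?_, fun v => ?_, fun S h2 hS => ?_⟩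
    · have := ht0 e he
      rcases hc with rfl | rfl <;> constructor <;> linarith
    · have hv : cutSum x {v} = 2 := hx.1.2.1 v
      have hne : ({v} : Finset (Fin n)) ≠ univ := fun h => by
        have := congrArg card h
        rw [card_singleton, card_univ, Fintype.card_fin] at this
        lia
      rw [hsum, htight _ (singleton_nonempty v) hne hv, hv]
      simp
    · rw [hsum]
      have := htS S ⟨card_pos.1 (by lia), fun h => by
        rw [h, card_univ, Fintype.card_fin] at hS
        lia⟩
      rcases hc with rfl | rfl <;> linarith
  intro e he
  have := hx.2 _ _ (hin t (Or.inl rfl)) (hin (-t) (Or.inr rfl)) (fun e _ => by ring) e he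
  have : t * d e = 0 := by linarith
  exact (mul_eq_zero.1 this).resolve_left ht.ne'

theorem mem_supportEdges {n : ℕ} {x : Sym2 (Fin n) → ℝ} {e : Sym2 (Fin n)} :
    e ∈ supportEdges x ↔ e ∈ edgeSet n ∧ 0 < x e := by
  simp [supportEdges]

theorem IsExtremePt.card_supportEdges_le {n : ℕ} (hn : 3 ≤ n) {x : Sym2 (Fin n) → ℝ}
    (hx : IsExtremePt n x) : #(supportEdges x) ≤ 2 * n - 3 := by
  let r : Fin n := ⟨0, by lia⟩
  set F : Finset (Finset (Fin n)) :=
    univ.filter fun S => S.Nonempty ∧ r ∉ S ∧ cutSum x S = 2 with hF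
  have hmemF : ∀ S, S ∈ F ↔ S.Nonempty ∧ r ∉ S ∧ cutSum x S = 2 := fun S => by simp [hF]
  have hproper : ∀ S : Finset (Fin n), r ∉ S → S ≠ univ := by
    rintro S hS rfl
    exact hS (mem_univ r)
  have huncross : ∀ S ∈ F, ∀ T ∈ F, (S ∩ T).Nonempty →
      S ∩ T ∈ F ∧ S ∪ T ∈ F ∧ ∀ e ∈ crossEdges S T, x e = 0 := by
    intro S hS T hT hI
    obtain ⟨hS0, hSr, hS2⟩ := (hmemF S).1 hS
    obtain ⟨hT0, hTr, hT2⟩ := (hmemF T).1 hT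
    have hU : r ∉ S ∪ T := by simp [hSr, hTr]
    obtain ⟨h1, h2, h3⟩ := hx.1.uncross hS2 hT2 hI (hproper _ hU)
    exact ⟨(hmemF _).2 ⟨hI, by simp [hSr], h1⟩,
      (hmemF _).2 ⟨hS0.mono subset_union_left, hU, h2⟩, h3⟩
  obtain ⟨L, hLF, hL, hdet⟩ := exists_laminar_determining_subfamily F
    fun S hS T hT hI => ⟨(huncross S hS T hT hI).1, (huncross S hS T hT hI).2.1⟩
  have hcardU : #(univ.erase r) = n - 1 := by
    rw [card_erase_of_mem (mem_univ r), card_univ, Fintype.card_fin]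
  have hcardL : #L + 1 ≤ 2 * #(univ.erase r) := by
    refine card_laminar_family_add_one_le _ (card_pos.1 (by lia)) L (fun S hS b hb => ?_)
      (fun S hS => ((hmemF S).1 (hLF hS)).1) hL
    exact mem_erase.2 ⟨fun h => ((hmemF S).1 (hLF hS)).2.1 (h ▸ hb), mem_univ b⟩
  by_contra! hlt
  let ext : (supportEdges x → ℝ) → Sym2 (Fin n) → ℝ :=
    fun w e => if h : e ∈ supportEdges x then w ⟨e, h⟩ else 0
  let Φ : (supportEdges x → ℝ) →ₗ[ℝ] (L → ℝ) :=
    { toFun := fun w S => cutSum (ext w) S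
      map_add' := fun w w' => by
        funext S
        simp only [cutSum, Pi.add_apply, ← sum_add_distrib]
        refine sum_congr rfl fun e _ => ?_
        by_cases h : e ∈ supportEdges x <;> simp [ext, h]
      map_smul' := fun c w => by
        funext S
        simp only [cutSum, Pi.smul_apply, smul_eq_mul, RingHom.id_apply, mul_sum]
        refine sum_congr rfl fun e _ => ?_
        by_cases h : e ∈ supportEdges x <;> simp [ext, h] }
  have hker : LinearMap.ker Φ ≠ ⊥ := LinearMap.ker_ne_bot_of_finrank_lt (by
    simp only [Module.finrank_fintype_fun_eq_card, Fintype.card_coe]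
    lia)
  obtain ⟨w, hw, hw0⟩ := (Submodule.ne_bot_iff _).1 hker
  have hdL : ∀ S ∈ L, cutSum (ext w) S = 0 := fun S hS =>
    congrFun (LinearMap.mem_ker.1 hw) ⟨S, hS⟩
  have hdx : ∀ e, x e = 0 → ext w e = 0 := fun e he =>
    dif_neg fun h => (mem_supportEdges.1 h).2.ne' he
  have hdF := hdet (cutSum (ext w)) (fun S hS T hT hI => by
    rw [cutSum_add_cutSum, sum_eq_zero fun e he => hdx e ((huncross S hS T hT hI).2.2 e he)]
    ring) hdL
  have hzero := hx.direction_eq_zero hn (d := ext w) (fun e _ => hdx e) fun S hS hS' hS2 => by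
    by_cases hr : r ∈ S
    · rw [← cutSum_compl]
      refine hdF _ ((hmemF _).2 ⟨?_, by simpa using hr, by rwa [cutSum_compl]⟩)
      rwa [nonempty_iff_ne_empty, Ne, compl_eq_empty_iff]
    · exact hdF S ((hmemF S).2 ⟨hS, hr, hS2⟩)
  refine hw0 (funext fun e => ?_)
  have := hzero e (mem_supportEdges.1 e.2).1
  simpa [ext] using this

theorem InSubtour.sum_cut_inter_supportEdges {n : ℕ} {x : Sym2 (Fin n) → ℝ}
    (hx : InSubtour n x) (S : Finset (Fin n)) :
    ∑ e ∈ cut S ∩ supportEdges x, x e = cutSum x S := by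
  refine sum_subset inter_subset_left fun e he hne => ?_
  have hE := cut_subset_edgeSet S he
  refine le_antisymm (not_lt.1 fun h => hne ?_) (hx.1 e hE).1
  exact mem_inter.2 ⟨he, mem_supportEdges.2 ⟨hE, h⟩⟩

theorem InSubtour.two_le_supDeg {n : ℕ} {x : Sym2 (Fin n) → ℝ} (hx : InSubtour n x) (v : Fin n) :
    2 ≤ supDeg x v := by
  have h2 : cutSum x {v} = 2 := hx.2.1 v
  have hle : ∑ e ∈ cut {v} ∩ supportEdges x, x e ≤ ∑ e ∈ cut {v} ∩ supportEdges x, (1 : ℝ) :=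
    sum_le_sum fun e he => (hx.1 e (cut_subset_edgeSet _ (mem_inter.1 he).1)).2
  rw [hx.sum_cut_inter_supportEdges, h2, sum_const, nsmul_eq_mul, mul_one] at hle
  exact_mod_cast hle

/-- Both support edges at a vertex of support degree two have value one. -/
theorem InSubtour.eq_one_of_supDeg_eq_two {n : ℕ} {x : Sym2 (Fin n) → ℝ} (hx : InSubtour n x)
    {v : Fin n} (hv : supDeg x v = 2) {e : Sym2 (Fin n)} (he : e ∈ cut {v})
    (hes : e ∈ supportEdges x) : x e = 1 := by
  have hle : ∀ e ∈ cut {v} ∩ supportEdges x, x e ≤ 1 := fun e he =>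
    (hx.1 e (cut_subset_edgeSet _ (mem_inter.1 he).1)).2
  refine (sum_eq_sum_iff_of_le hle).1 ?_ e (mem_inter.2 ⟨he, hes⟩)
  rw [hx.sum_cut_inter_supportEdges, sum_const, show #(cut {v} ∩ supportEdges x) = 2 from hv]
  simpa [cutSum] using hx.2.1 v

theorem sum_supDeg {n : ℕ} (x : Sym2 (Fin n) → ℝ) :
    ∑ v, supDeg x v = 2 * #(supportEdges x) := by
  have hdeg : ∀ v, supDeg x v = ∑ e ∈ supportEdges x, if e ∈ cut {v} then 1 else 0 := by
    intro v
    rw [← card_filter, supDeg, inter_comm, filter_mem_eq_inter]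
  simp only [hdeg]
  rw [sum_comm, mul_comm, ← smul_eq_mul, ← sum_const]
  refine sum_congr rfl fun e he => ?_
  rw [← card_filter]
  induction e using Sym2.ind with
  | _ a b =>
    have hab := mem_edgeSet.1 (mem_supportEdges.1 he).1
    rw [← card_pair hab]
    congr 1
    ext v
    simp only [mem_filter, mem_univ, true_and, mem_cut, mem_singleton, mem_insert]
    grind

theorem InSubtour.le_card_supportEdges {n : ℕ} {x : Sym2 (Fin n) → ℝ} (hx : InSubtour n x) :
    n ≤ #(supportEdges x) := by
  have h : ∑ _v : Fin n, 2 ≤ ∑ v, supDeg x v := sum_le_sum fun v _ => hx.two_le_supDeg v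
  rw [sum_supDeg, sum_const, card_univ, Fintype.card_fin, smul_eq_mul] at h
  lia

theorem InSubtour.supDeg_eq_two {n : ℕ} {x : Sym2 (Fin n) → ℝ} (hx : InSubtour n x)
    (hm : #(supportEdges x) = n) (v : Fin n) : supDeg x v = 2 := by
  have h : ∑ _v : Fin n, 2 = ∑ v, supDeg x v := by
    rw [sum_supDeg, hm, sum_const, card_univ, Fintype.card_fin, smul_eq_mul, mul_comm]
  exact ((sum_eq_sum_iff_of_le fun v _ => hx.two_le_supDeg v).1 h v (mem_univ v)).symm

theorem injective_mk_apply_of_isCycle {n : ℕ} (hn : 3 ≤ n) {σ : Equiv.Perm (Fin n)}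
    (hσ : σ.IsCycle) (hsupp : σ.support = univ) :
    Function.Injective fun v => s(v, σ v) := by
  intro v w h
  rcases Sym2.eq_iff.1 h with ⟨h, -⟩ | ⟨h1, h2⟩
  · exact h
  · exfalso
    have hv : σ v ≠ v := Equiv.Perm.mem_support.1 (hsupp ▸ mem_univ v)
    have hpow : σ ^ 2 = 1 := (hσ.pow_eq_one_iff' hv).2 (by
      rw [pow_two, Equiv.Perm.mul_apply, h2, ← h1])
    have hord := orderOf_dvd_of_pow_eq_one hpow
    rw [hσ.orderOf, hsupp, card_univ, Fintype.card_fin] at hord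
    have := Nat.le_of_dvd two_pos hord
    lia

theorem card_image_mk_apply_of_isCycle {n : ℕ} (hn : 3 ≤ n) {σ : Equiv.Perm (Fin n)}
    (hσ : σ.IsCycle) (hsupp : σ.support = univ) :
    #(univ.image fun v => s(v, σ v)) = n := by
  rw [card_image_of_injective _ (injective_mk_apply_of_isCycle hn hσ hsupp), card_univ,
    Fintype.card_fin]

theorem IsHamCycle.card_supportEdges {n : ℕ} (hn : 3 ≤ n) {x : Sym2 (Fin n) → ℝ}
    (hx : IsHamCycle n x) : #(supportEdges x) = n := by
  obtain ⟨σ, hσ, hsupp, hval⟩ := hx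
  refine Eq.trans (congrArg card ?_) (card_image_mk_apply_of_isCycle hn hσ hsupp)
  ext e
  simp only [mem_supportEdges, mem_image, mem_univ, true_and]
  constructor
  · rintro ⟨he, hpos⟩
    rw [hval e he] at hpos
    by_contra h
    rw [if_neg fun ⟨v, hv⟩ => h ⟨v, hv.symm⟩] at hpos
    exact hpos.false
  · rintro ⟨v, rfl⟩
    have he : s(v, σ v) ∈ edgeSet n :=
      mem_edgeSet.2 (Equiv.Perm.mem_support.1 (hsupp ▸ mem_univ v)).symm
    refine ⟨he, ?_⟩
    rw [hval _ he, if_pos ⟨v, rfl⟩]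
    exact one_pos

/-- The closed walk of a cycle through all vertices is traversed by a cyclic permutation. -/
theorem exists_isCycle_perm_of_spanning_cycle {V : Type*} [Fintype V] [DecidableEq V]
    {G : SimpleGraph V} {u : V} (p : G.Walk u u) (hp : p.IsCycle) (hspan : ∀ v, v ∈ p.support) :
    ∃ σ : Equiv.Perm V, σ.IsCycle ∧ σ.support = univ ∧ ∀ v, G.Adj v (σ v) := by
  have hlen : p.support.tail.length = p.length := by simp
  have hthree := hp.three_le_length
  have hnodup : p.support.tail.Nodup := hp.support_nodup
  have hmem : ∀ v, v ∈ p.support.tail := by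
    intro v
    rcases p.mem_support_iff.1 (hspan v) with rfl | h
    · exact p.end_mem_tail_support hp.not_nil
    · exact h
  have hget : ∀ (i : ℕ) (hi : i < p.support.tail.length),
      p.support.tail[i] = p.getVert (i + 1) := by
    intro i hi
    rw [List.getElem_tail, SimpleGraph.Walk.support_getElem_eq_getVert]
  refine ⟨p.support.tail.formPerm, List.isCycle_formPerm hnodup (by lia), ?_, fun v => ?_⟩
  · rw [List.support_formPerm_of_nodup _ hnodup fun x h => by
      rw [h, List.length_singleton] at hlen
      lia]
    exact eq_univ_of_forall fun v => List.mem_toFinset.2 (hmem v)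
  · obtain ⟨i, hi, rfl⟩ := List.getElem_of_mem (hmem v)
    rw [List.formPerm_apply_getElem _ hnodup, hget, hget]
    rcases (Nat.succ_le_of_lt hi).lt_or_eq with h | h
    · rw [Nat.mod_eq_of_lt h]
      exact p.adj_getVert_succ (by lia)
    · rw [show i + 1 = p.support.tail.length from h, Nat.mod_self, hlen, p.getVert_length]
      simpa using p.adj_getVert_succ (i := 0) (by lia)

theorem InSubtour.isHamCycle_of_card_supportEdges {n : ℕ} (hn : 3 ≤ n) {x : Sym2 (Fin n) → ℝ}
    (hx : InSubtour n x) (hm : #(supportEdges x) = n) : IsHamCycle n x := by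
  let G : SimpleGraph (Fin n) := SimpleGraph.fromEdgeSet (supportEdges x : Set (Sym2 (Fin n)))
  have hadj : ∀ u v, G.Adj u v ↔ s(u, v) ∈ supportEdges x := by
    intro u v
    simp only [G, SimpleGraph.fromEdgeSet_adj, mem_coe, and_iff_left_iff_imp]
    exact fun h => mem_edgeSet.1 (mem_supportEdges.1 h).1
  have hdeg : ∀ v, (G.neighborSet v).ncard = 2 := by
    intro v
    rw [← hx.supDeg_eq_two hm v, supDeg, ← Set.ncard_coe_finset,
      ← Set.ncard_image_of_injective (G.neighborSet v) (f := fun w => s(v, w))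
        fun a b h => Sym2.congr_right.1 h]
    congr 1
    ext e
    induction e using Sym2.ind with
    | _ a b =>
      have hs : s(b, a) = s(a, b) := Sym2.eq_swap
      simp only [Set.mem_image, SimpleGraph.mem_neighborSet, hadj, mem_coe, mem_inter, mem_cut,
        mem_singleton]
      constructor
      · rintro ⟨w, hw, h⟩
        have hne := mem_edgeSet.1 (mem_supportEdges.1 hw).1
        rw [← h]
        refine ⟨?_, hw⟩
        rcases Sym2.eq_iff.1 h with ⟨rfl, rfl⟩ | ⟨rfl, rfl⟩ <;> simp [hne.symm]
      · rintro ⟨⟨rfl, -⟩ | ⟨rfl, -⟩, h⟩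
        · exact ⟨b, h, rfl⟩
        · exact ⟨a, hs ▸ h, hs⟩
  have hne : ∀ v, (G.neighborSet v).Nonempty := fun v =>
    (Set.ncard_pos (Set.toFinite _)).1 (by rw [hdeg v]; exact two_pos)
  let r : Fin n := ⟨0, by lia⟩
  let c := G.connectedComponentMk r
  have hconn : ∀ v, v ∈ c.supp := by
    let S : Finset (Fin n) := univ.filter fun v => v ∈ c.supp
    have hS : S = univ := by
      by_contra hS
      have h2 := hx.two_le_cutSum (S := S) ⟨r, by simp [S, c]⟩ hS
      rw [← hx.sum_cut_inter_supportEdges, sum_eq_zero] at h2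
      · norm_num at h2
      · intro e
        induction e using Sym2.ind with
        | _ a b =>
          intro he
          obtain ⟨hcut, hsup⟩ := mem_inter.1 he
          have := SimpleGraph.ConnectedComponent.mem_supp_congr_adj c ((hadj a b).2 hsup)
          simp only [mem_cut, S, mem_filter, mem_univ, true_and] at hcut
          tauto
    intro v
    have hv : v ∈ S := hS ▸ mem_univ v
    simpa [S] using hv
  obtain ⟨p, hp, hverts⟩ :=
    SimpleGraph.IsCycles.exists_cycle_toSubgraph_verts_eq_connectedComponentSupp
      (fun v _ => hdeg v) (hconn r) (hne r)
  obtain ⟨σ, hσ, hsupp, hσadj⟩ := exists_isCycle_perm_of_spanning_cycle p hp fun v => by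
    rw [← SimpleGraph.Walk.mem_verts_toSubgraph, hverts]
    exact hconn v
  have himage : univ.image (fun v => s(v, σ v)) = supportEdges x := by
    refine eq_of_subset_of_card_le ?_ ?_
    · intro e he
      obtain ⟨v, -, rfl⟩ := mem_image.1 he
      exact (hadj _ _).1 (hσadj v)
    · rw [card_image_mk_apply_of_isCycle hn hσ hsupp, hm]
  refine ⟨σ, hσ, hsupp, fun e he => ?_⟩
  have hiff : (∃ v, e = s(v, σ v)) ↔ e ∈ supportEdges x := by
    rw [← himage, mem_image]
    simp [eq_comm]
  rw [if_congr hiff rfl rfl]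
  split_ifs with h
  · induction e using Sym2.ind with
    | _ a b =>
      refine hx.eq_one_of_supDeg_eq_two (hx.supDeg_eq_two hm a) ?_ h
      simp [mem_cut, (mem_edgeSet.1 he).symm]
  · exact le_antisymm (not_lt.1 fun hpos => h (mem_supportEdges.2 ⟨he, hpos⟩)) (hx.1 e he).1

/-- The number `m` of support edges of an extreme point satisfies
`n ≤ m ≤ 2n - 3`, with `m = n` iff `x` is the incidence vector of a
Hamiltonian cycle. -/
theorem support_card_bounds (n : ℕ) (hn : 3 ≤ n) (x : Sym2 (Fin n) → ℝ)
    (hx : IsExtremePt n x) :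
    n ≤ (supportEdges x).card ∧ (supportEdges x).card ≤ 2 * n - 3 ∧
      ((supportEdges x).card = n ↔ IsHamCycle n x) := by
  exact ⟨hx.1.le_card_supportEdges, hx.card_supportEdges_le hn,
    hx.1.isHamCycle_of_card_supportEdges hn, fun h => h.card_supportEdges hn⟩
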